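/- Let g be a complex semisimple Lie algebra, (f,h,e) an sl₂-triple, and h_z = z(e) the centralizer of e. On the quotient V = g/z(e), the operator E induced by ad e is well defined, and V carries an sl₂-module structure in which E acts as the raising operator and the semisimple element acts as (the operator induced by ad h) + Id. In particular, there exist operators F, H on V with H = (induced ad h) + Id, [H,E] = 2E, [H,F] = −2F, [E,F] = H. -/

import Mathlib

open Polynomial in
/-- A polynomial vanishing on all eigenvalues of `T` evaluates at `T` to a nilpotent operator. -/
lemma aux_dvd_pow (m q : ℂ[X]) (hm : m ≠ 0) (hq : ∀ a, m.eval a = 0 → q.eval a = 0) :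
    m ∣ q ^ (m.natDegree + 1) := by
  by_cases hq0 : q = 0
  · simp [hq0]
  refine (IsAlgClosed.splits m).dvd_of_roots_le_roots hm ?_
  rw [Multiset.le_iff_count]
  intro a
  rw [roots_pow, Multiset.count_nsmul]
  by_cases ha : a ∈ m.roots
  · have h1 : 1 ≤ Multiset.count a q.roots := by
      rw [Multiset.one_le_count_iff_mem, mem_roots hq0]
      exact hq a (by simpa using (mem_roots hm).1 ha)
    have h2 : Multiset.count a m.roots ≤ m.natDegree :=
      (Multiset.count_le_card _ _).trans (card_roots' m)
    nlinarith
  · rw [Multiset.count_eq_zero_of_notMem ha]; exact Nat.zero_le _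

open Polynomial in
/-- Square roots of invertible operators, with prescribed branch on the spectrum. -/
lemma aux_sqrt {V : Type*} [AddCommGroup V] [Module ℂ V] [FiniteDimensional ℂ V]
    (Ω : Module.End ℂ V) (s : ℂ → ℂ)
    (hs : ∀ μ, Ω.HasEigenvalue μ → s μ ^ 2 = μ ∧ μ ≠ 0) :
    ∃ D : Module.End ℂ V, D * D = Ω ∧ (∀ T, Commute T Ω → Commute T D) ∧
      ∀ (d : ℂ) (x : V), x ≠ 0 → D x = d • x → d = s (d ^ 2) := by
  classical
  set m := minpoly ℂ Ω with hm_def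
  have hint : IsIntegral ℂ Ω := Algebra.IsIntegral.isIntegral Ω
  have hm : m ≠ 0 := minpoly.ne_zero hint
  set p : ℂ[X] := Lagrange.interpolate m.roots.toFinset id s with hp_def
  have hp : ∀ a, m.eval a = 0 → p.eval a = s a := by
    intro a ha
    have : a ∈ m.roots.toFinset := by
      rw [Multiset.mem_toFinset, mem_roots hm]; exact ha
    exact Lagrange.eval_interpolate_at_node (v := id) s (Set.injOn_id _) this
  have heig : ∀ a, m.eval a = 0 → s a ^ 2 = a ∧ a ≠ 0 := fun a ha =>
    hs a (Module.End.hasEigenvalue_of_isRoot ha)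
  let S := Algebra.adjoin ℂ {Ω}
  let ω : S := ⟨Ω, Algebra.subset_adjoin rfl⟩
  letI : CommRing S := Algebra.adjoinCommRingOfComm ℂ (by
    rintro a rfl b rfl; rfl)
  have hval : ∀ q : ℂ[X], ((aeval ω q : S) : Module.End ℂ V) = aeval Ω q := by
    intro q
    exact (Polynomial.aeval_algHom_apply S.val ω q).symm
  have hmω : aeval ω m = 0 := by
    apply Subtype.ext
    rw [hval]
    exact minpoly.aeval ℂ Ω
  let P : S[X] := X ^ 2 - C ω
  have hnil : IsNilpotent (aeval (aeval ω p) P) := by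
    have : aeval (aeval ω p) P = aeval ω (p ^ 2 - X) := by
      simp [P]
    rw [this]
    refine ⟨m.natDegree + 1, ?_⟩
    rw [← map_pow]
    obtain ⟨c, hc⟩ := aux_dvd_pow m (p ^ 2 - X) hm (by
      intro a ha
      simp [hp a ha, (heig a ha).1])
    rw [hc, map_mul, hmω, zero_mul]
  have hunit : IsUnit (aeval (aeval ω p) (derivative P)) := by
    have h1 : aeval (aeval ω p) (derivative P) = aeval ω (C 2 * p) := by
      simp [P, one_add_one_eq_two]
      exact congrArg (· * aeval ω p) (map_ofNat (algebraMap ℂ S) 2).symm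
    rw [h1]
    have hcop : IsCoprime (C 2 * p) m := by
      rw [Polynomial.isCoprime_iff_aeval_ne_zero_of_isAlgClosed (k := ℂ) (K := ℂ)]
      intro a
      by_cases ha : m.eval a = 0
      · left
        have := heig a ha
        simp only [coe_aeval_eq_eval, eval_mul, eval_C, hp a ha]
        intro h0
        have h0' : s a = 0 := by simpa using h0
        rw [h0'] at this
        exact this.2 (by simpa using this.1.symm)
      · right; simpa using ha
    obtain ⟨a, b, hab⟩ := hcop
    have := congrArg (aeval ω) hab
    rw [map_add, map_mul, map_mul (aeval ω) b m, hmω, mul_zero, add_zero, map_one] at this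
    exact IsUnit.of_mul_eq_one_right _ this
  obtain ⟨r, ⟨hr1, hr2⟩, -⟩ := existsUnique_nilpotent_sub_and_aeval_eq_zero hnil hunit
  have hrr : r * r = ω := by
    have : r ^ 2 - ω = 0 := by simpa [P] using hr2
    rw [← sq]; exact sub_eq_zero.1 this
  have hrΩ : (r : Module.End ℂ V) * r = Ω := congrArg Subtype.val hrr
  refine ⟨r, hrΩ, ?_, ?_⟩
  · intro T hT
    exact (Algebra.commute_of_mem_adjoin_singleton_of_commute r.2 hT)
  · intro d x hx hdx
    have hΩx : Ω x = (d ^ 2) • x := by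
      rw [← hrΩ, Module.End.mul_apply, hdx, map_smul, hdx, smul_smul, sq]
    have hev : Ω.HasEigenvector (d ^ 2) x := ⟨Module.End.mem_eigenspace_iff.2 hΩx, hx⟩
    have hroot : m.eval (d ^ 2) = 0 :=
      Module.End.isRoot_of_hasEigenvalue (Module.End.hasEigenvalue_of_hasEigenvector hev)
    have hN : IsNilpotent (aeval Ω p - (r : Module.End ℂ V)) := by
      have := hr1.map S.val
      rw [map_sub] at this
      rw [← hval]; exact this
    have hpx : (aeval Ω p - (r : Module.End ℂ V)) x = (s (d ^ 2) - d) • x := by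
      rw [LinearMap.sub_apply, Module.End.aeval_apply_of_hasEigenvector hev, hp _ hroot, hdx,
        sub_smul]
    have hev2 : (aeval Ω p - (r : Module.End ℂ V)).HasEigenvector (s (d ^ 2) - d) x :=
      ⟨Module.End.mem_eigenspace_iff.2 hpx, hx⟩
    have := (Module.End.hasEigenvalue_of_hasEigenvector hev2).isNilpotent_of_isNilpotent hN
    exact (sub_eq_zero.1 this.eq_zero).symm

/-- The raising operator is nilpotent. -/
lemma aux_nilp {V : Type*} [AddCommGroup V] [Module ℂ V] [FiniteDimensional ℂ V]
    (e h : Module.End ℂ V) (he : h * e = e * h + 2 • e) : IsNilpotent e := by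
  by_contra hcon
  have hpow : ∀ k : ℕ, h * e ^ k = e ^ k * h + (2 * k) • e ^ k := by
    intro k
    induction k with
    | zero => simp
    | succ k ih =>
      rw [pow_succ, ← mul_assoc, ih, add_mul, mul_assoc, he, mul_add, smul_mul_assoc,
        mul_smul_comm, mul_assoc, add_assoc, ← add_smul]
      congr 2
      ring
  let A : Module.End ℂ (Module.End ℂ V) := LinearMap.mulLeft ℂ h - LinearMap.mulRight ℂ h
  have hA : ∀ k : ℕ, A.HasEigenvalue (2 * k : ℂ) := by
    intro k
    refine Module.End.hasEigenvalue_of_hasEigenvector (x := e ^ k)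
      ⟨Module.End.mem_eigenspace_iff.2 ?_, fun h0 => hcon ⟨k, h0⟩⟩
    simp only [A, LinearMap.sub_apply, LinearMap.mulLeft_apply, LinearMap.mulRight_apply, hpow]
    rw [add_sub_cancel_left, ← Nat.cast_smul_eq_nsmul ℂ]
    push_cast
    rfl
  have hfin : Set.Finite {μ | A.HasEigenvalue μ} := Module.End.finite_hasEigenvalue A
  refine Set.infinite_of_injective_forall_mem (f := fun k : ℕ => (2 * k : ℂ)) ?_ hA hfin
  intro a b hab
  simpa using hab

/-- Invariant nonzero subspaces contain vectors killed by `e` and `h`-eigen. -/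
lemma aux_prim {V : Type*} [AddCommGroup V] [Module ℂ V] [FiniteDimensional ℂ V]
    (e h : Module.End ℂ V) (he : h * e = e * h + 2 • e) (N : Submodule ℂ V) (hN : N ≠ ⊥)
    (hNe : ∀ x ∈ N, e x ∈ N) (hNh : ∀ x ∈ N, h x ∈ N) :
    ∃ x ∈ N, x ≠ 0 ∧ e x = 0 ∧ ∃ μ : ℂ, h x = μ • x := by
  obtain ⟨k, hk⟩ := aux_nilp e h he
  have step : ∀ (k : ℕ) (x : V), x ∈ N → x ≠ 0 → (e ^ k) x = 0 → ∃ y ∈ N, y ≠ 0 ∧ e y = 0 := by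
    intro k
    induction k with
    | zero => intro x _ h0 h1; exact absurd (by simpa using h1) h0
    | succ k ih =>
      intro x hx h0 h1
      by_cases hex : e x = 0
      · exact ⟨x, hx, h0, hex⟩
      · exact ih (e x) (hNe x hx) hex (by rwa [pow_succ] at h1)
  obtain ⟨x0, hx0, hx0'⟩ := N.ne_bot_iff.1 hN
  obtain ⟨y, hy, hy0, hey⟩ := step k x0 hx0 hx0' (by rw [hk]; rfl)
  let W : Submodule ℂ V := N ⊓ LinearMap.ker e
  have hW : ∀ x ∈ W, h x ∈ W := by
    rintro x ⟨h1, h2⟩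
    refine ⟨hNh x h1, ?_⟩
    have h2' : e x = 0 := h2
    have := congrArg (fun T : Module.End ℂ V => T x) he
    simp [h2'] at this
    exact this.symm
  have : Nontrivial W := ⟨⟨⟨y, hy, hey⟩, 0, fun h0 => hy0 (congrArg Subtype.val h0)⟩⟩
  obtain ⟨μ, hμ⟩ := Module.End.exists_eigenvalue (h.restrict hW)
  obtain ⟨v, hv⟩ := hμ.exists_hasEigenvector
  refine ⟨v, v.2.1, fun h0 => hv.2 (Subtype.ext h0), v.2.2, μ, ?_⟩
  have := congrArg Subtype.val hv.apply_eq_smul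
  simpa using this

/-- Algebra: the core construction. -/
lemma aux_core {V : Type*} [AddCommGroup V] [Module ℂ V] [FiniteDimensional ℂ V]
    (e h f : Module.End ℂ V) (hef : e * f = f * e + h) (hhe : h * e = e * h + 2 • e)
    (hhf : h * f = f * h - 2 • f)
    (hnat : ∀ x : V, x ≠ 0 → e x = 0 → ∀ μ : ℂ, h x = μ • x → ∃ n : ℕ, μ = n) :
    ∃ F : Module.End ℂ V, (∀ x, e x = 0 → e (F x) = 0) ∧ h * F - F * h = -(2 • F) ∧
      e * (e * F - F * e - (h + 1)) = 0 := by
  let Ω : Module.End ℂ V := 4 • (f * e) + (h + 1) * (h + 1)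
  have hΩe : Commute e Ω := by
    change e * (4 • (f * e) + (h + 1) * (h + 1)) = (4 • (f * e) + (h + 1) * (h + 1)) * e
    have h1 : e * (f * e) = f * e * e + h * e := by rw [← mul_assoc, hef, add_mul]
    have h2 : h * h * e = e * h * h + 4 • (e * h) + 4 • e := by
      rw [mul_assoc, hhe, mul_add, ← mul_assoc, hhe, mul_smul_comm, hhe]
      noncomm_ring
    have : e * (4 • (f * e) + (h + 1) * (h + 1)) - (4 • (f * e) + (h + 1) * (h + 1)) * e
      = 4 • (e * (f * e)) - 4 • (f * e * e) + e * h * h + 2 • (e * h) - h * h * e - 2 • (h * e) := by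
      noncomm_ring
    rw [← sub_eq_zero, this, h1, h2, hhe]
    noncomm_ring
  have hΩf : Commute f Ω := by
    change f * (4 • (f * e) + (h + 1) * (h + 1)) = (4 • (f * e) + (h + 1) * (h + 1)) * f
    have h1 : f * e * f = f * (f * e) + f * h := by rw [mul_assoc, hef, mul_add]
    have h2 : h * h * f = f * h * h - 4 • (f * h) + 4 • f := by
      rw [mul_assoc, hhf, mul_sub, ← mul_assoc, hhf, mul_smul_comm, hhf]
      noncomm_ring
    have : f * (4 • (f * e) + (h + 1) * (h + 1)) - (4 • (f * e) + (h + 1) * (h + 1)) * f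
      = 4 • (f * (f * e)) - 4 • (f * e * f) + f * h * h + 2 • (f * h) - h * h * f - 2 • (h * f) := by
      noncomm_ring
    rw [← sub_eq_zero, this, h1, h2, hhf]
    noncomm_ring
  have hΩh : Commute h Ω := by
    have h3 : h = e * f - f * e := by rw [hef]; abel
    have := (hΩe.mul_left hΩf).sub_left (hΩf.mul_left hΩe)
    rwa [← h3] at this
  have hΩprim : ∀ x : V, e x = 0 → ∀ μ : ℂ, h x = μ • x → Ω x = ((μ + 1) ^ 2) • x := by
    intro x hx μ hμ
    simp only [Ω, LinearMap.add_apply, LinearMap.smul_apply, Module.End.mul_apply, hx, map_zero,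
      smul_zero, zero_add, Module.End.one_apply, hμ, map_add, map_smul]
    module
  have hre : ∀ n : ℕ, (((n : ℂ) + 1) ^ 2) ^ (2⁻¹ : ℂ) = (n : ℂ) + 1 := fun n =>
    Complex.sq_cpow_two_inv (by simp; positivity)
  obtain ⟨D, hDD, hDc, hDs⟩ := aux_sqrt Ω (fun z => z ^ (2⁻¹ : ℂ)) (by
    intro μ hμ
    obtain ⟨x, hx, hx0, hex, ν, hν⟩ := aux_prim e h hhe (Ω.eigenspace μ) hμ
      (by
        intro x hx
        rw [Module.End.mem_eigenspace_iff] at hx ⊢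
        have := congrArg (fun T : Module.End ℂ V => T x) hΩe.eq
        simp only [Module.End.mul_apply, hx, map_smul] at this
        exact this.symm)
      (by
        intro x hx
        rw [Module.End.mem_eigenspace_iff] at hx ⊢
        have := congrArg (fun T : Module.End ℂ V => T x) hΩh.eq
        simp only [Module.End.mul_apply, hx, map_smul] at this
        exact this.symm)
    obtain ⟨n, rfl⟩ := hnat x hx0 hex ν hν
    have h1 := hΩprim x hex _ hν
    rw [Module.End.mem_eigenspace_iff.1 hx] at h1
    have h2 : μ = ((n : ℂ) + 1) ^ 2 := smul_left_injective ℂ hx0 h1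
    have h3 : (n : ℂ) + 1 ≠ 0 := Nat.cast_add_one_ne_zero n
    subst h2
    exact ⟨by simp only [hre], pow_ne_zero _ h3⟩)
  have hDe := (hDc e hΩe).eq
  have hDf := (hDc f hΩf).eq
  have hDh := (hDc h hΩh).eq
  -- on `ker e`, `D = h + 1`
  have hDprim : ∀ x : V, e x = 0 → D x = h x + x := by
    intro x hx
    by_contra hcon
    let N : Submodule ℂ V := LinearMap.ker e ⊓ LinearMap.ker (D + h + 1)
    have hcomm : ∀ y : V, D (h y) = h (D y) := fun y => by
      have := congrArg (fun T : Module.End ℂ V => T y) hDh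
      exact this.symm
    have hker : ∀ y, e y = 0 → e (h y) = 0 := by
      intro y hy
      have := congrArg (fun T : Module.End ℂ V => T y) hhe
      simp [hy] at this
      exact this.symm
    have hkerD : ∀ y, e y = 0 → e (D y) = 0 := by
      intro y hy
      have := congrArg (fun T : Module.End ℂ V => T y) hDe
      simp [hy] at this
      exact this
    have hN : N ≠ ⊥ := by
      rw [N.ne_bot_iff]
      refine ⟨D x - (h x + x), ⟨?_, ?_⟩, sub_ne_zero.2 hcon⟩
      · simp [hx, hker x hx, hkerD x hx]
      · have h1 := congrArg (fun T : Module.End ℂ V => T x) hDD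
        simp only [Ω, LinearMap.add_apply, LinearMap.smul_apply, Module.End.mul_apply, hx, map_zero,
          smul_zero, zero_add, Module.End.one_apply, map_add] at h1
        change D (D x - (h x + x)) + h (D x - (h x + x)) + (D x - (h x + x)) = 0
        simp only [map_sub, map_add, h1, hcomm]
        abel
    obtain ⟨y, hy, hy0, hey, ν, hν⟩ := aux_prim e h hhe N hN
      (by
        rintro y ⟨hy, -⟩
        have : e y = 0 := hy
        rw [this]; exact N.zero_mem)
      (by
        rintro y ⟨hy, hy2⟩
        refine ⟨hker y hy, ?_⟩
        have h1 : D y + h y + y = 0 := hy2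
        have h2 : h (D y + h y + y) = 0 := by rw [h1, map_zero]
        simpa [hcomm] using h2)
    obtain ⟨n, rfl⟩ := hnat y hy0 hey ν hν
    have h1 : D y + h y + y = 0 := hy.2
    have h2 : D y = (-((n : ℂ) + 1)) • y := by
      rw [hν] at h1
      rw [← sub_eq_zero, ← h1]
      module
    have h3 := hDs _ y hy0 h2
    simp only [neg_sq, hre] at h3
    have h4 : (n : ℂ) + 1 = 0 := by linear_combination (-1 / 2) * h3
    exact Nat.cast_add_one_ne_zero n h4
  -- the operator `K`
  obtain ⟨K, hK⟩ : ∃ K : Module.End ℂ V, 2 • K = D - h - 1 :=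
    ⟨(1 / 2 : ℂ) • (D - h - 1), by
      rw [← Nat.cast_smul_eq_nsmul ℂ, smul_smul]; norm_num⟩
  have hh : h = D - 2 • K - 1 := by rw [hK]; abel
  have two_inj : ∀ A B : Module.End ℂ V, 2 • A = 2 • B → A = B := fun A B hAB =>
by
    have h1 : (2 : ℂ) • A = (2 : ℂ) • B := by simpa only [two_smul] using hAB
    exact smul_right_injective _ (two_ne_zero (α := ℂ)) h1
  have hKe : K * e = e * K - e := by
    apply two_inj
    rw [← smul_mul_assoc, smul_sub, ← mul_smul_comm, hK, sub_mul, sub_mul, mul_sub, mul_sub, hhe,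
      hDe]
    noncomm_ring
  have hKf : K * f = f * K + f := by
    apply two_inj
    rw [← smul_mul_assoc, smul_add, ← mul_smul_comm, hK, sub_mul, sub_mul, mul_sub, mul_sub, hhf,
      hDf]
    noncomm_ring
  have hDK : D * K = K * D := by
    apply two_inj
    rw [← mul_smul_comm, ← smul_mul_assoc, hK, sub_mul, sub_mul, mul_sub, mul_sub, hDh]
    noncomm_ring
  have hfe : f * e = K * (D - K) := by
    apply two_inj
    apply two_inj
    have h1 : 4 • (f * e) = D * D - (h + 1) * (h + 1) := by rw [hDD]; simp [Ω]
    have h2 : h + 1 = D - 2 • K := by rw [hh]; abel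
    have h3 : 2 • 2 • (f * e) = 4 • (f * e) := by rw [smul_smul]; norm_num
    rw [h3, h1, h2]
    simp only [sub_mul, mul_sub, smul_mul_assoc, mul_smul_comm, hDK]
    noncomm_ring
  have hef' : e * f = (K + 1) * (D - K - 1) := by
    rw [hef, hfe, hh]
    noncomm_ring
  have hKker : ∀ x, e x = 0 → K x = 0 := by
    intro x hx
    have h1 := congrArg (fun T : Module.End ℂ V => T x) hK
    simp only [LinearMap.smul_apply, LinearMap.sub_apply, Module.End.one_apply, hDprim x hx] at h1
    have h2 : (2 : ℂ) • K x = 0 := by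
      rw [two_smul, ← two_nsmul, h1]; abel
    exact (smul_eq_zero.1 h2).resolve_left two_ne_zero
  have hinj : ∀ (m c : ℕ) (x : V), (e ^ m) x = 0 → K x = (-((c : ℂ) + 1)) • x → x = 0 := by
    intro m
    induction m with
    | zero => intro c x h0 _; simpa using h0
    | succ m ih =>
      intro c x h0 hKx
      have hex : e x = 0 := by
        refine ih (c + 1) (e x) (by rwa [pow_succ] at h0) ?_
        have := congrArg (fun T : Module.End ℂ V => T x) hKe
        simp only [Module.End.mul_apply, LinearMap.sub_apply, hKx, map_smul] at this
        rw [this]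
        push_cast
        module
      rw [hKker x hex] at hKx
      exact (smul_eq_zero.1 hKx.symm).resolve_left
        (neg_ne_zero.2 (Nat.cast_add_one_ne_zero c))
  have hKunit : IsUnit (K + 1) := by
    rw [LinearMap.isUnit_iff_ker_eq_bot, LinearMap.ker_eq_bot']
    intro x hx
    obtain ⟨m, hm⟩ := aux_nilp e h hhe
    refine hinj m 0 x (by rw [hm]; rfl) ?_
    have : K x + x = 0 := hx
    rw [eq_neg_of_add_eq_zero_left this]
    simp
  obtain ⟨U, hU⟩ := hKunit
  obtain ⟨u, hu1, hu2⟩ : ∃ u, (K + 1) * u = 1 ∧ u * (K + 1) = 1 :=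
    ⟨(U⁻¹ : (Module.End ℂ V)ˣ), by rw [← hU]; simp, by rw [← hU]; simp⟩
  have hDK1 : Commute D K := hDK
  have hhK : Commute h K := by
    rw [hh]
    exact (hDK1.sub_left ((Commute.refl K).smul_left 2)).sub_left (Commute.one_left K)
  have hhu : h * u = u * h := by
    have h1 : (K + 1) * h = h * (K + 1) := by rw [add_mul, mul_add, hhK.eq]; simp
    calc h * u = (u * (K + 1)) * (h * u) := by rw [hu2, one_mul]
      _ = u * ((K + 1) * h) * u := by noncomm_ring
      _ = u * (h * (K + 1)) * u := by rw [h1]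
      _ = u * h * ((K + 1) * u) := by noncomm_ring
      _ = u * h := by rw [hu1, mul_one]
  have heF : e * (f * K * u) = (D - K - 1) * K := by
    calc e * (f * K * u) = (e * f) * K * u := by noncomm_ring
      _ = (K + 1) * (D - K - 1) * K * u := by rw [hef']
      _ = ((D - K - 1) * K) * ((K + 1) * u) := by
        have : (K + 1) * (D - K - 1) * K = ((D - K - 1) * K) * (K + 1) := by
          have hc : Commute (K + 1) ((D - K - 1) * K) := by
            have hcK : Commute K (D - K - 1) :=
              (hDK1.symm.sub_right (Commute.refl K)).sub_right (Commute.one_right K)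
            exact (hcK.mul_right (Commute.refl K)).add_left (Commute.one_left _)
          rw [mul_assoc, hc.eq]
        rw [this, mul_assoc]
      _ = (D - K - 1) * K := by rw [hu1, mul_one]
  refine ⟨f * K * u, ?_, ?_, ?_⟩
  · intro x hx
    have := congrArg (fun T : Module.End ℂ V => T x) heF
    simp only [Module.End.mul_apply, hKker x hx, map_zero] at this
    exact this
  · have h1 : h * (f * K * u) = f * K * u * h - 2 • (f * K * u) := by
      calc h * (f * K * u) = (h * f) * K * u := by noncomm_ring
        _ = f * (h * K) * u - 2 • (f * K * u) := by rw [hhf]; noncomm_ring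
        _ = f * K * (h * u) - 2 • (f * K * u) := by rw [hhK.eq]; noncomm_ring
        _ = f * K * u * h - 2 • (f * K * u) := by rw [hhu]; noncomm_ring
    rw [h1]; abel
  · have h1 : e * (e * (f * K * u) - f * K * u * e - (h + 1))
        = e * (e * (f * K * u)) - (e * (f * K * u)) * e - e * (h + 1) := by noncomm_ring
    have h2 : (D - K - 1) * K * e = e * ((D - K) * (K - 1)) := by
      have h3 : (D - K - 1) * e = e * (D - K) := by
        rw [sub_mul, sub_mul, ← hDe, hKe]; noncomm_ring
      rw [mul_assoc, hKe, show e * K - e = e * (K - 1) by noncomm_ring, ← mul_assoc, h3, mul_assoc]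
    rw [h1, heF, h2, hh]
    noncomm_ring

/-- On `V = g / z(e)` the operator `E` induced by `ad e` is part of an
sl₂-triple `(F, H, E)` of endomorphisms of `V` with `H = (induced ad h) + Id`. -/
theorem sl2_triple_on_quotient_by_centralizer
    {g : Type*} [LieRing g] [LieAlgebra ℂ g] [LieAlgebra.IsSemisimple ℂ g]
    [FiniteDimensional ℂ g] {h e f : g} (t : IsSl2Triple h e f) :
    ∃ E H F : Module.End ℂ (g ⧸ LinearMap.ker (LieAlgebra.ad ℂ g e)),
      (∀ ξ : g, E (Submodule.Quotient.mk ξ) = Submodule.Quotient.mk ⁅e, ξ⁆) ∧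
      (∀ ξ : g, H (Submodule.Quotient.mk ξ) =
        Submodule.Quotient.mk ⁅h, ξ⁆ + Submodule.Quotient.mk ξ) ∧
      H * E - E * H = 2 • E ∧ H * F - F * H = -(2 • F) ∧ E * F - F * E = H := by
  set a := LieAlgebra.ad ℂ g with ha
  have hef : a e * a f = a f * a e + a h := by
    ext x
    have := leibniz_lie e f x
    rw [t.lie_e_f] at this
    change ⁅e, ⁅f, x⁆⁆ = ⁅f, ⁅e, x⁆⁆ + ⁅h, x⁆
    rw [this]; abel
  have hhe : a h * a e = a e * a h + 2 • a e := by
    ext x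
    have := leibniz_lie h e x
    rw [t.lie_h_e_nsmul, nsmul_lie] at this
    change ⁅h, ⁅e, x⁆⁆ = ⁅e, ⁅h, x⁆⁆ + 2 • ⁅e, x⁆
    rw [this]; abel
  have hhf : a h * a f = a f * a h - 2 • a f := by
    ext x
    have := leibniz_lie h f x
    rw [t.lie_h_f_nsmul, neg_lie, nsmul_lie] at this
    change ⁅h, ⁅f, x⁆⁆ = ⁅f, ⁅h, x⁆⁆ - 2 • ⁅f, x⁆
    rw [this]; abel
  obtain ⟨F, hF1, hF2, hF3⟩ := aux_core (a e) (a h) (a f) hef hhe hhf (by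
    intro x hx0 hex μ hμ
    have P : t.HasPrimitiveVectorWith x μ := ⟨hx0, hμ, hex⟩
    exact P.exists_nat)
  have hhk : LinearMap.ker (a e) ≤ (LinearMap.ker (a e)).comap (a h + 1) := by
    intro x hx
    have hx' : a e x = 0 := hx
    have := congrArg (fun T : Module.End ℂ g => T x) hhe
    simp only [Module.End.mul_apply, LinearMap.add_apply, LinearMap.smul_apply, hx', map_zero,
      smul_zero, add_zero] at this
    simp only [Submodule.mem_comap, LinearMap.mem_ker, LinearMap.add_apply, Module.End.one_apply,
      map_add, hx', add_zero]
    exact this.symm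
  refine ⟨(LinearMap.ker (a e)).mapQ _ (a e) ?_, (LinearMap.ker (a e)).mapQ _ (a h + 1) hhk,
    (LinearMap.ker (a e)).mapQ _ F hF1, ?_, ?_, ?_, ?_, ?_⟩
  · intro x hx
    have hx' : a e x = 0 := hx
    simp [hx']
  · intro ξ; rfl
  · intro ξ; rfl
  · ext x
    have := congrArg (fun T : Module.End ℂ g => T x) hhe
    simp only [Module.End.mul_apply, LinearMap.add_apply, LinearMap.smul_apply] at this
    simp [this]
  · ext x
    have h1 : (a h + 1) * F - F * (a h + 1) = -(2 • F) := by
      rw [← hF2]; noncomm_ring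
    have h2 := congrArg (fun T : Module.End ℂ g =>
      Submodule.Quotient.mk (p := LinearMap.ker (a e)) (T x)) h1
    exact h2
  · ext x
    have := congrArg (fun T : Module.End ℂ g => T x) hF3
    have h2 : Submodule.Quotient.mk (p := LinearMap.ker (a e))
        ((a e * F - F * a e - (a h + 1)) x) = 0 := (Submodule.Quotient.mk_eq_zero _).2 this
    rw [LinearMap.sub_apply, Submodule.Quotient.mk_sub, sub_eq_zero] at h2
    exact h2
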